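/- Let ABCD be an isosceles tetrahedron and let Ω be its circumsphere, with center O and radius R, so that A, B, C, D ∈ Ω. Let X ∈ Ω with X ∉ {A, B, C, D} (so X lies on no line through two vertices of ABCD), and let Y be an isogonal conjugate of X with respect to ABCD. Then Y ∈ Ω, i.e. dist(O, Y) = R. In other words, the circumsphere of an isosceles tetrahedron is invariant under isogonal conjugation. -/

import Mathlib

open EuclideanGeometry
open scoped RealInnerProductSpace

noncomputable section

abbrev Pt := EuclideanSpace ℝ (Fin 3)

/-- The unit vector in the direction of `v` (junk value `0` if `v = 0`). -/
def unitv (v : Pt) : Pt := ‖v‖⁻¹ • v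

/-- The unit vector in the direction of the component of `v` orthogonal to the
unit vector `u`. -/
def orthUnit (v u : Pt) : Pt := unitv (v - ⟪v, u⟫ • u)

/-- The internal bisector plane of tetrahedron `XYZW` along the edge `XY`:
the affine plane through `X` whose direction is spanned by the unit vector `u` along
`Y - X` and the sum of the unit vectors along the components of `Z - X` and `W - X`
orthogonal to `u`. -/
def bisectorPlane (X Y Z W : Pt) : AffineSubspace ℝ Pt :=
  AffineSubspace.mk' X (Submodule.span ℝ
    {unitv (Y - X), orthUnit (Z - X) (unitv (Y - X)) + orthUnit (W - X) (unitv (Y - X))})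

/-- Reflection of `ℝ³` in the internal bisector plane along edge `XY`
(with `Z`, `W` the two remaining vertices). -/
def edgeReflect (X Y Z W : Pt) : Pt ≃ᵃⁱ[ℝ] Pt :=
  haveI : Nonempty (bisectorPlane X Y Z W) := ⟨⟨X, AffineSubspace.self_mem_mk' _ _⟩⟩
  EuclideanGeometry.reflection (bisectorPlane X Y Z W)

/-- `Q` lies in the image of the plane through `X, Y, P` under the reflection of `ℝ³`
in the internal bisector plane along the edge `XY` (remaining vertices `Z`, `W`). -/
def IsogCond (X Y Z W P Q : Pt) : Prop :=
  Q ∈ ⇑(edgeReflect X Y Z W) '' (affineSpan ℝ ({X, Y, P} : Set Pt) : Set Pt)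

/-- `Q` is an isogonal conjugate of `P` with respect to the tetrahedron `ABCD`:
for each of the six edges `XY`, `Q` lies in the image of the plane through `X, Y, P`
under the reflection in the internal bisector plane along `XY`. -/
def IsIsogonalConjugate (A B C D P Q : Pt) : Prop :=
  IsogCond A B C D P Q ∧ IsogCond A C B D P Q ∧ IsogCond A D B C P Q ∧
  IsogCond B C A D P Q ∧ IsogCond B D A C P Q ∧ IsogCond C D A B P Q

/-- Orthogonal projection of `P` onto the affine plane spanned by `X, Y, Z`. -/
def faceProj (X Y Z P : Pt) : Pt :=
  haveI : Nonempty (affineSpan ℝ ({X, Y, Z} : Set Pt)) :=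
    ⟨⟨X, subset_affineSpan ℝ _ (by simp)⟩⟩
  (EuclideanGeometry.orthogonalProjection (affineSpan ℝ ({X, Y, Z} : Set Pt)) P : Pt)

/-- Barycentric uniqueness for four affinely independent points, as a linear relation. -/
def NoRelation (A B C D : Pt) : Prop :=
  ∀ a b c d : ℝ, a + b + c + d = 0 → a • A + b • B + c • C + d • D = 0 →
    a = 0 ∧ b = 0 ∧ c = 0 ∧ d = 0

theorem NoRelation.of_affineIndependent {A B C D : Pt}
    (h : AffineIndependent ℝ ![A, B, C, D]) : NoRelation A B C D := by
  intro a b c d hs hv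
  have key := affineIndependent_iff.1 h Finset.univ ![a, b, c, d]
    (by simpa [Fin.sum_univ_four] using hs) (by simpa [Fin.sum_univ_four] using hv)
  exact ⟨key 0 (Finset.mem_univ _), key 1 (Finset.mem_univ _), key 2 (Finset.mem_univ _),
    key 3 (Finset.mem_univ _)⟩

theorem exists_barycentric {A B C D : Pt} (h : AffineIndependent ℝ ![A, B, C, D]) (P : Pt) :
    ∃ a b c d : ℝ, a + b + c + d = 1 ∧ P = a • A + b • B + c • C + d • D := by
  have htop : affineSpan ℝ (Set.range ![A, B, C, D]) = ⊤ := by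
    rw [h.affineSpan_eq_top_iff_card_eq_finrank_add_one]
    simp
  let β : AffineBasis (Fin 4) ℝ Pt := ⟨![A, B, C, D], h, htop⟩
  refine ⟨β.coord 0 P, β.coord 1 P, β.coord 2 P, β.coord 3 P, ?_, ?_⟩
  · have := β.sum_coord_apply_eq_one P
    rwa [Fin.sum_univ_four] at this
  · have := β.linear_combination_coord_eq_self P
    rw [Fin.sum_univ_four] at this
    exact this.symm

theorem exists_smul_of_mem_affineSpan_triple {X Y P T : Pt}
    (hT : T ∈ affineSpan ℝ ({X, Y, P} : Set Pt)) :
    ∃ s t : ℝ, T - X = s • (Y - X) + t • (P - X) := by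
  have hle : affineSpan ℝ ({X, Y, P} : Set Pt) ≤
      AffineSubspace.mk' X (Submodule.span ℝ {Y - X, P - X}) := by
    rw [affineSpan_le]
    rintro Z (rfl | rfl | rfl)
    · exact AffineSubspace.self_mem_mk' _ _
    · exact AffineSubspace.mem_mk'.2 (Submodule.subset_span (by simp))
    · exact AffineSubspace.mem_mk'.2 (Submodule.subset_span (by simp))
  obtain ⟨s, t, hst⟩ := Submodule.mem_span_pair.1 (AffineSubspace.mem_mk'.1 (hle hT))
  exact ⟨s, t, hst.symm⟩

theorem norm_smul_unitv (v : Pt) : ‖v‖ • unitv v = v := by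
  by_cases hv : v = 0
  · simp [hv]
  · rw [unitv, smul_smul, mul_inv_cancel₀ (norm_ne_zero_iff.2 hv), one_smul]

theorem inner_unitv_self {v : Pt} (hv : v ≠ 0) : ⟪unitv v, unitv v⟫ = 1 := by
  have := norm_ne_zero_iff.2 hv
  rw [unitv, real_inner_smul_left, real_inner_smul_right, real_inner_self_eq_norm_sq]
  field_simp

/-- If `p` and `q` have equal length and are orthogonal to `u`, the reflection in the span of `u`
and the sum of the unit vectors along `p` and `q` swaps `p` and `q`. -/
theorem reflection_span_swaps {u p q : Pt} (hup : ⟪u, p⟫ = 0) (huq : ⟪u, q⟫ = 0)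
    (hpq : ‖p‖ = ‖q‖) :
    (Submodule.span ℝ {u, unitv p + unitv q}).reflection p = q := by
  set K := Submodule.span ℝ {u, unitv p + unitv q} with hK
  have hsum : p + q ∈ K := by
    have : p + q = ‖p‖ • (unitv p + unitv q) := by
      rw [smul_add, norm_smul_unitv, hpq, norm_smul_unitv]
    rw [this]
    exact K.smul_mem _ (Submodule.subset_span (by simp))
  have hdiff : p - q ∈ Kᗮ := by
    rw [Submodule.mem_orthogonal]
    intro z hz
    obtain ⟨s, t, rfl⟩ := Submodule.mem_span_pair.1 hz
    have h0 : ⟪p, p⟫ = ⟪q, q⟫ := by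
      rw [real_inner_self_eq_norm_sq, real_inner_self_eq_norm_sq, hpq]
    simp only [unitv, hpq, inner_add_left, inner_sub_right, real_inner_smul_left, hup, huq,
      real_inner_comm p q, h0]
    ring
  have h1 := K.reflection_mem_subspace_eq_self hsum
  have h2 := K.reflection_mem_subspace_orthogonalComplement_eq_neg hdiff
  have hp : p = (1 / 2 : ℝ) • (p + q) + (1 / 2 : ℝ) • (p - q) := by module
  calc K.reflection p
      = K.reflection ((1 / 2 : ℝ) • (p + q) + (1 / 2 : ℝ) • (p - q)) := by rw [← hp]
    _ = (1 / 2 : ℝ) • (p + q) + (1 / 2 : ℝ) • (-(p - q)) := by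
      rw [map_add, map_smul, map_smul, h1, h2]
    _ = q := by module

theorem edgeReflect_apply (X Y Z W T : Pt) :
    edgeReflect X Y Z W T =
      (Submodule.span ℝ {unitv (Y - X), orthUnit (Z - X) (unitv (Y - X)) +
        orthUnit (W - X) (unitv (Y - X))}).reflection (T - X) + X := by
  have hX : X ∈ bisectorPlane X Y Z W := AffineSubspace.self_mem_mk' _ _
  have : Nonempty (bisectorPlane X Y Z W) := ⟨⟨X, hX⟩⟩
  have h := reflection_apply_of_mem (bisectorPlane X Y Z W) T hX
  have hd : (bisectorPlane X Y Z W).direction = Submodule.span ℝ {unitv (Y - X),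
      orthUnit (Z - X) (unitv (Y - X)) + orthUnit (W - X) (unitv (Y - X))} :=
    AffineSubspace.direction_mk' _ _
  simp only [hd] at h
  exact h

/-- When the faces at the edge `XY` have equal altitudes onto `XY`, the isogonality condition at
this edge says that the products of corresponding barycentric coordinates agree. -/
theorem IsogCond.mul_eq_mul {X Y Z W P Q : Pt} (hind : NoRelation X Y Z W)
    (hXZ : dist X Z = dist Y W) (hXW : dist X W = dist Y Z)
    {a b c d a' b' c' d' : ℝ}
    (hs : a + b + c + d = 1) (hP : P = a • X + b • Y + c • Z + d • W)
    (hs' : a' + b' + c' + d' = 1) (hQ : Q = a' • X + b' • Y + c' • Z + d' • W)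
    (h : IsogCond X Y Z W P Q) : c * c' = d * d' := by
  obtain ⟨T, hT, hTQ⟩ := h
  obtain ⟨s, t, hst⟩ := exists_smul_of_mem_affineSpan_triple hT
  rw [edgeReflect_apply] at hTQ
  have hYX : Y - X ≠ 0 := by
    intro h0
    have := (hind (-1) 1 0 0 (by norm_num) (by rw [← h0]; module)).2.1
    norm_num at this
  set u := unitv (Y - X) with hu
  set l := ‖Y - X‖ with hl
  have hlu : Y - X = l • u := (norm_smul_unitv _).symm
  have hl0 : l ≠ 0 := norm_ne_zero_iff.2 hYX
  have huu : ⟪u, u⟫ = 1 := inner_unitv_self hYX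
  set z := ⟪Z - X, u⟫ with hz
  set w := ⟪W - X, u⟫ with hw
  set p := Z - X - z • u with hp
  set q := W - X - w • u with hq
  have hup : ⟪u, p⟫ = 0 := by
    rw [hp, inner_sub_right, real_inner_smul_right, huu, real_inner_comm, ← hz]; ring
  have huq : ⟪u, q⟫ = 0 := by
    rw [hq, inner_sub_right, real_inner_smul_right, huu, real_inner_comm, ← hw]; ring
  have hZX : Z - X = z • u + p := by rw [hp]; module
  have hWX : W - X = w • u + q := by rw [hq]; module
  have hpq : ‖p‖ = ‖q‖ := by
    have e1 : ⟪Z - X, Z - X⟫ = ⟪W - Y, W - Y⟫ := by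
      rw [real_inner_self_eq_norm_sq, real_inner_self_eq_norm_sq, ← dist_eq_norm, ← dist_eq_norm,
        dist_comm Z, dist_comm W, hXZ]
    have e2 : ⟪W - X, W - X⟫ = ⟪Z - Y, Z - Y⟫ := by
      rw [real_inner_self_eq_norm_sq, real_inner_self_eq_norm_sq, ← dist_eq_norm, ← dist_eq_norm,
        dist_comm Z, dist_comm W, hXW]
    have hZY : Z - Y = (z - l) • u + p := by
      rw [sub_smul, ← hlu, hp]; module
    have hWY : W - Y = (w - l) • u + q := by
      rw [sub_smul, ← hlu, hq]; module
    rw [hZX, hWY] at e1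
    rw [hWX, hZY] at e2
    simp only [inner_add_left, inner_add_right, real_inner_smul_left, real_inner_smul_right, huu,
      hup, huq, real_inner_comm u p, real_inner_comm u q] at e1 e2
    have hzw : z + w = l := by
      have : l * (z + w - l) = 0 := by linarith
      have := (mul_eq_zero.1 this).resolve_left hl0
      linarith
    have e3 : ⟪p, p⟫ = ⟪q, q⟫ := by
      rw [← hzw] at e1
      linarith
    rw [real_inner_self_eq_norm_sq, real_inner_self_eq_norm_sq] at e3
    exact (sq_eq_sq₀ (norm_nonneg _) (norm_nonneg _)).1 e3
  have hpo : orthUnit (Z - X) u = unitv p := rfl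
  have hqo : orthUnit (W - X) u = unitv q := rfl
  rw [hpo, hqo] at hTQ
  have rp := reflection_span_swaps hup huq hpq
  have rq : (Submodule.span ℝ {u, unitv p + unitv q}).reflection q = p := by
    rw [add_comm]
    exact reflection_span_swaps huq hup hpq.symm
  have ru : (Submodule.span ℝ {u, unitv p + unitv q}).reflection u = u :=
    Submodule.reflection_mem_subspace_eq_self (Submodule.subset_span (by simp))
  have hPX : P - X = b • (Y - X) + c • (Z - X) + d • (W - X) := by
    rw [hP, show a = 1 - b - c - d by linarith]; module
  have hQX : Q - X = b' • (Y - X) + c' • (Z - X) + d' • (W - X) := by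
    rw [hQ, show a' = 1 - b' - c' - d' by linarith]; module
  have hTX : T - X = (s * l + t * (b * l + c * z + d * w)) • u + (t * c) • p + (t * d) • q := by
    rw [hst, hPX, hZX, hWX, hlu]; module
  rw [hTX, map_add, map_add, map_smul, map_smul, map_smul, ru, rp, rq] at hTQ
  set m := s * l + t * (b * l + c * z + d * w) with hm
  have hlin : (m - t * c * w - t * d * z) • u + (t * d) • (Z - X) + (t * c) • (W - X) =
      b' • (Y - X) + c' • (Z - X) + d' • (W - X) := by
    rw [← hQX, ← hTQ, hZX, hWX]; module
  set k := (m - t * c * w - t * d * z) / l with hk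
  have hku : (m - t * c * w - t * d * z) • u = k • (Y - X) := by
    rw [hlu, smul_smul, hk, div_mul_cancel₀ _ hl0]
  rw [hku] at hlin
  obtain ⟨-, -, hc, hd⟩ := hind (-(k - b') - (t * d - c') - (t * c - d')) (k - b') (t * d - c')
    (t * c - d') (by ring) (by
      rw [← sub_eq_zero] at hlin
      rw [← hlin]; module)
  rw [← sub_eq_zero.1 hc, ← sub_eq_zero.1 hd]
  ring

/-- The power of a point with respect to a sphere through the vertices, in barycentric
coordinates. -/
theorem dist_sq_barycentric {A B C D O P : Pt} {R : ℝ}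
    (hA : dist O A = R) (hB : dist O B = R) (hC : dist O C = R) (hD : dist O D = R)
    {a b c d : ℝ} (hs : a + b + c + d = 1) (hP : P = a • A + b • B + c • C + d • D) :
    dist O P ^ 2 = R ^ 2 - (a * b * dist A B ^ 2 + a * c * dist A C ^ 2 + a * d * dist A D ^ 2 +
      b * c * dist B C ^ 2 + b * d * dist B D ^ 2 + c * d * dist C D ^ 2) := by
  have hPO : P - O = a • (A - O) + b • (B - O) + c • (C - O) + d • (D - O) := by
    rw [hP, ← sub_eq_zero, show a = 1 - b - c - d by linarith]; module
  have hsub : ∀ U V : Pt, dist U V ^ 2 = dist O U ^ 2 + dist O V ^ 2 - 2 * ⟪U - O, V - O⟫ := by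
    intro U V
    rw [dist_comm O U, dist_comm O V, dist_eq_norm, dist_eq_norm, dist_eq_norm,
      ← sub_sub_sub_cancel_right U V O, norm_sub_sq_real]
    ring
  have hself : ∀ U : Pt, ⟪U - O, U - O⟫ = dist O U ^ 2 := by
    intro U
    rw [real_inner_self_eq_norm_sq, dist_comm, dist_eq_norm]
  rw [hsub A B, hsub A C, hsub A D, hsub B C, hsub B D, hsub C D, ← hself P, hPO]
  simp only [inner_add_left, inner_add_right, real_inner_smul_left, real_inner_smul_right, hself,
    hA, hB, hC, hD, real_inner_comm (A - O) (B - O), real_inner_comm (A - O) (C - O),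
    real_inner_comm (A - O) (D - O), real_inner_comm (B - O) (C - O),
    real_inner_comm (B - O) (D - O), real_inner_comm (C - O) (D - O)]
  rw [show a = 1 - b - c - d by linarith]
  ring

/-- A line through two points of a sphere meets the sphere only in these points. -/
theorem eq_or_eq_of_dist_eq {U V O P : Pt} {R : ℝ} (hU : dist O U = R) (hV : dist O V = R)
    (hP : dist O P = R) {x y : ℝ} (hs : x + y = 1) (h : P = x • U + y • V) : P = U ∨ P = V := by
  have key := dist_sq_barycentric (P := P) hU hV hV hV (a := x) (b := y) (c := 0) (d := 0)
    (by linarith) (by rw [h]; module)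
  have h0 : x * y * dist U V ^ 2 = 0 := by rw [hP] at key; linarith
  rcases mul_eq_zero.1 h0 with h1 | h1
  · rcases mul_eq_zero.1 h1 with rfl | rfl
    · right; simpa [show y = 1 by linarith] using h
    · left; simpa [show x = 1 by linarith] using h
  · left
    have hUV : U = V := dist_eq_zero.1 (pow_eq_zero_iff two_ne_zero |>.1 h1)
    rw [h, ← hUV, ← add_smul, hs, one_smul]

/-- The quadric `l (ab + cd) + m (bc + ad) + n (ac + bd) = 0` is preserved by inverting the
coordinates, away from points with two vanishing coordinates. -/
theorem quadric_of_mul_eq {l m n a b c d a' b' c' d' : ℝ}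
    (h : l * (a * b + c * d) + m * (b * c + a * d) + n * (a * c + b * d) = 0)
    (hab : a * a' = b * b') (hac : a * a' = c * c') (had : a * a' = d * d')
    (nab : a ≠ 0 ∨ b ≠ 0) (nac : a ≠ 0 ∨ c ≠ 0) (nad : a ≠ 0 ∨ d ≠ 0)
    (nbc : b ≠ 0 ∨ c ≠ 0) (nbd : b ≠ 0 ∨ d ≠ 0) (ncd : c ≠ 0 ∨ d ≠ 0) :
    l * (a' * b' + c' * d') + m * (b' * c' + a' * d') + n * (a' * c' + b' * d') = 0 := by
  by_cases ha : a = 0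
  · simp_all
  by_cases hb : b = 0
  · simp_all
  by_cases hc : c = 0
  · simp_all
  by_cases hd : d = 0
  · simp_all
  set k := a * a' with hk
  have ea : a' = k / a := by rw [hk]; field_simp
  have eb : b' = k / b := by rw [hab]; field_simp
  have ec : c' = k / c := by rw [hac]; field_simp
  have ed : d' = k / d := by rw [had]; field_simp
  clear_value k
  subst ea eb ec ed
  have : l * (k / a * (k / b) + k / c * (k / d)) + m * (k / b * (k / c) + k / a * (k / d)) +
      n * (k / a * (k / c) + k / b * (k / d)) = k ^ 2 / (a * b * c * d) *
      (l * (a * b + c * d) + m * (b * c + a * d) + n * (a * c + b * d)) := by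
    field_simp
    ring
  rw [this, h, mul_zero]

/-- The circumsphere of an isosceles tetrahedron is invariant under isogonal
conjugation: if `X` lies on the circumsphere of the isosceles tetrahedron `ABCD` and is
not a vertex, then any isogonal conjugate `Y` of `X` with respect to `ABCD` also lies on
the circumsphere. -/
theorem isogonal_conjugate_of_circumsphere_point_lies_on_circumsphere
    (A B C D : Pt) (hindep : AffineIndependent ℝ ![A, B, C, D])
    (h₁ : dist A B = dist C D) (h₂ : dist B C = dist A D) (h₃ : dist A C = dist B D)
    (O : Pt) (R : ℝ)
    (hOA : dist O A = R) (hOB : dist O B = R) (hOC : dist O C = R) (hOD : dist O D = R)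
    (X Y : Pt) (hX : dist O X = R) (hXv : X ∉ ({A, B, C, D} : Set Pt))
    (hY : IsIsogonalConjugate A B C D X Y) :
    dist O Y = R := by
  have hind := NoRelation.of_affineIndependent hindep
  obtain ⟨a, b, c, d, hs, hP⟩ := exists_barycentric hindep X
  obtain ⟨a', b', c', d', hs', hQ⟩ := exists_barycentric hindep Y
  obtain ⟨yAB, yAC, yAD, yBC, yBD, yCD⟩ := hY
  have hcd : c * c' = d * d' := yAB.mul_eq_mul hind h₃ h₂.symm hs hP hs' hQ
  have hbd : b * b' = d * d' := by
    refine yAC.mul_eq_mul (a := a) (b := c) (a' := a') (b' := c') ?_ ?_ ?_ ?_ ?_ ?_ ?_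
    · intro p q r s h0 hv
      have := hind p r q s (by linarith) (by rw [← hv]; module)
      tauto
    · exact h₁
    · rw [dist_comm C B]; exact h₂.symm
    · linarith
    · rw [hP]; module
    · linarith
    · rw [hQ]; module
  have had : a * a' = d * d' := by
    refine yBC.mul_eq_mul (a := b) (b := c) (a' := b') (b' := c') ?_ ?_ ?_ ?_ ?_ ?_ ?_
    · intro p q r s h0 hv
      have := hind r p q s (by linarith) (by rw [← hv]; module)
      tauto
    · rw [dist_comm B A]; exact h₁
    · rw [dist_comm C A]; exact h₃.symm
    · linarith
    · rw [hP]; module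
    · linarith
    · rw [hQ]; module
  have pX := dist_sq_barycentric hOA hOB hOC hOD hs hP
  have pY := dist_sq_barycentric hOA hOB hOC hOD hs' hQ
  simp only [Set.mem_insert_iff, Set.mem_singleton_iff, not_or] at hXv
  obtain ⟨nA, nB, nC, nD⟩ := hXv
  have hline : ∀ {U V : Pt} (x y : ℝ), dist O U = R → dist O V = R → X ≠ U → X ≠ V →
      x + y = 1 → X ≠ x • U + y • V := fun _ _ hU hV nU nV hxy hXe =>
    (eq_or_eq_of_dist_eq hU hV hX hxy hXe).elim nU nV
  have hquad := quadric_of_mul_eq (l := dist A B ^ 2) (m := dist B C ^ 2) (n := dist A C ^ 2)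
    (a := a) (b := b) (c := c) (d := d) (a' := a') (b' := b') (c' := c') (d' := d')
    (by rw [hX, ← h₁, ← h₂, ← h₃] at pX; linarith)
    (had.trans hbd.symm) (had.trans hcd.symm) had
    (by
      by_contra! h0
      exact hline c d hOC hOD nC nD (by linarith) (by rw [hP, h0.1, h0.2]; module))
    (by
      by_contra! h0
      exact hline b d hOB hOD nB nD (by linarith) (by rw [hP, h0.1, h0.2]; module))
    (by
      by_contra! h0
      exact hline b c hOB hOC nB nC (by linarith) (by rw [hP, h0.1, h0.2]; module))
    (by
      by_contra! h0
      exact hline a d hOA hOD nA nD (by linarith) (by rw [hP, h0.1, h0.2]; module))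
    (by
      by_contra! h0
      exact hline a c hOA hOC nA nC (by linarith) (by rw [hP, h0.1, h0.2]; module))
    (by
      by_contra! h0
      exact hline a b hOA hOB nA nB (by linarith) (by rw [hP, h0.1, h0.2]; module))
  have hsq : dist O Y ^ 2 = R ^ 2 := by
    rw [← h₁, ← h₂, ← h₃] at pY
    linarith
  exact (sq_eq_sq₀ dist_nonneg (hOA ▸ dist_nonneg)).1 hsq

end
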